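/- Let k be a field with separable closure k^s, and let Y be a scheme that is proper over Spec k, reduced, and connected, such that the finite field extension H⁰(Y, O_Y) of k is separable over k. Then the number of connected components of the base change Y ×_{Spec k} Spec k^s equals dim_k H⁰(Y, O_Y). -/

import Mathlib

open AlgebraicGeometry CategoryTheory CategoryTheory.Limits
universe u

lemma aux_topo {X ι : Type*} [TopologicalSpace X] (U : ι → Set X) (ho : ∀ i, IsOpen (U i))
    (hd : ∀ i j, i ≠ j → U i ∩ U j = ∅) (hc : ∀ x, ∃ i, x ∈ U i) (hn : ∀ i, (U i).Nonempty)
    (hp : ∀ i, IsPreconnected (U i)) : Nat.card (_root_.ConnectedComponents X) = Nat.card ι := by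
  have hcl : ∀ i, IsClopen (U i) := by
    intro i
    refine ⟨⟨?_⟩, ho i⟩
    have : (U i)ᶜ = ⋃ j : {j // j ≠ i}, U j := by
      ext x
      simp only [Set.mem_compl_iff, Set.mem_iUnion, Subtype.exists, exists_prop]
      constructor
      · intro h
        obtain ⟨j, hj⟩ := hc x
        exact ⟨j, by rintro rfl; exact h hj, hj⟩
      · rintro ⟨j, hj, hx⟩ h
        have : x ∈ U j ∩ U i := ⟨hx, h⟩
        rw [hd j i hj] at this
        exact this
    rw [this]
    exact isOpen_iUnion fun j => ho _
  choose p hp' using hn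
  symm
  apply Nat.card_congr
  refine Equiv.ofBijective (fun i => (ConnectedComponents.mk (p i))) ⟨?_, ?_⟩
  · intro i j h
    by_contra hij
    have h := ConnectedComponents.coe_eq_coe.mp h
    have h1 : p j ∈ U i := (hcl i).connectedComponent_subset (hp' i) (h ▸ mem_connectedComponent)
    have : p j ∈ U i ∩ U j := ⟨h1, hp' j⟩
    rw [hd i j hij] at this
    exact this
  · intro x
    obtain ⟨x, rfl⟩ := ConnectedComponents.surjective_coe x
    obtain ⟨i, hi⟩ := hc x
    refine ⟨i, ?_⟩
    exact ConnectedComponents.coe_eq_coe.mpr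
      (connectedComponent_eq ((hp i).subset_connectedComponent (hp' i) hi))

lemma aux_field (k A : Type*) [Field k] [CommRing A] [Nontrivial A] [Algebra k A]
    [Algebra.IsSeparable k A] (h : ∀ e : A, e * e = e → e = 0 ∨ e = 1) : IsField A := by
  refine ⟨⟨0, 1, zero_ne_one⟩, mul_comm, ?_⟩
  intro a ha
  have hs := Algebra.IsSeparable.isSeparable k a
  have hi := hs.isIntegral
  set p := minpoly k a with hpdef
  have hpa : Polynomial.aeval a p = 0 := minpoly.aeval k a
  by_cases h0 : p.coeff 0 = 0
  · obtain ⟨q, hq⟩ := Polynomial.X_dvd_iff.mpr h0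
    have hcop : IsCoprime Polynomial.X q := by
      have : p.Separable := hs
      rw [hq] at this
      exact this.isCoprime
    obtain ⟨r, s, hrs⟩ := hcop
    have h1 := congrArg (Polynomial.aeval a) hrs
    rw [hq] at hpa
    simp only [map_add, map_mul, Polynomial.aeval_X, map_one] at h1 hpa
    set e := Polynomial.aeval a s * Polynomial.aeval a q with he
    have hea : a * e = 0 := by rw [he]; linear_combination Polynomial.aeval a s * hpa
    rcases h e (by linear_combination e * h1 - Polynomial.aeval a r * hea) with h2 | h2
    · exact ⟨Polynomial.aeval a r, by linear_combination h1 - h2⟩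
    · rw [h2, mul_one] at hea; exact absurd hea ha
  · have h1 : p = Polynomial.X * p.divX + Polynomial.C (p.coeff 0) := (Polynomial.X_mul_divX_add p).symm
    rw [h1] at hpa
    simp only [map_add, map_mul, Polynomial.aeval_X, Polynomial.aeval_C] at hpa
    have h3 : algebraMap k A (p.coeff 0) * algebraMap k A (p.coeff 0)⁻¹ = 1 := by
      rw [← map_mul, mul_inv_cancel₀ h0, map_one]
    exact ⟨- Polynomial.aeval a p.divX * algebraMap k A (p.coeff 0)⁻¹, by linear_combination h3 -  algebraMap k A (p.coeff 0)⁻¹ * hpa⟩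

lemma aux_clopen (X : Scheme.{u}) (U V : X.Opens) (hd : U ⊓ V = ⊥) (hc : U ⊔ V = ⊤) :
    ∃ a : Γ(X, ⊤), X.basicOpen a = U := by
  have hsub : Subsingleton Γ(X, U ⊓ V) := by
    rw [hd]; infer_instance
  have hsub' : Subsingleton Γ(X, V ⊓ U) := by
    rw [inf_comm]; infer_instance
  obtain ⟨a, ha, -⟩ := X.sheaf.existsUnique_gluing' (fun t : Bool => cond t U V) ⊤
    (fun i => homOfLE le_top) (by
      rw [← hc]; exact sup_le (le_iSup (fun t : Bool => cond t U V) true) (le_iSup (fun t : Bool => cond t U V) false))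
    (fun t => match t with | true => (1 : Γ(X, U)) | false => (0 : Γ(X, V))) (by
      rintro (_ | _) (_ | _)
      · rfl
      · exact hsub'.elim _ _
      · exact hsub.elim _ _
      · rfl)
  have h1 := ha true
  have h0 := ha false
  change X.presheaf.map _ a = (1 : Γ(X, U)) at h1
  change X.presheaf.map _ a = (0 : Γ(X, V)) at h0
  refine ⟨a, ?_⟩
  have e1 := X.basicOpen_res a (homOfLE (le_top : U ≤ ⊤)).op
  have e0 := X.basicOpen_res a (homOfLE (le_top : V ≤ ⊤)).op
  rw [h1, Scheme.basicOpen_of_isUnit _ isUnit_one] at e1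
  rw [h0, Scheme.basicOpen_zero] at e0
  apply le_antisymm
  · calc X.basicOpen a = (U ⊔ V) ⊓ X.basicOpen a := by rw [hc, top_inf_eq]
      _ = (U ⊓ X.basicOpen a) ⊔ (V ⊓ X.basicOpen a) := inf_sup_right _ _ _
      _ ≤ U := by rw [← e0, ← e1]; simp
  · rw [← inf_eq_left]; exact e1.symm

lemma aux_unit (X : Scheme.{u}) (a : Γ(X, ⊤)) (h : X.basicOpen a = ⊤) : IsUnit a := by
  refine X.toLocallyRingedSpace.toRingedSpace.isUnit_of_isUnit_germ ⊤ a fun x hx => ?_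
  exact (X.mem_basicOpen_top a x).mp (by rw [h]; trivial)

lemma aux_cover (X : Scheme.{u}) {ι : Type*} [Fintype ι] (a : ι → Γ(X, ⊤)) (h : ∑ i, a i = 1) (x : X) :
    ∃ i, x ∈ X.basicOpen (a i) := by
  by_contra! hx
  simp only [Scheme.mem_basicOpen_top] at hx
  have h2 : X.presheaf.germ ⊤ x trivial 1 ∈ IsLocalRing.maximalIdeal (X.presheaf.stalk x) := by
    rw [← h, map_sum]
    exact Ideal.sum_mem _ fun i _ => hx i
  rw [map_one] at h2
  exact (Ideal.ne_top_iff_one _).mp (IsLocalRing.maximalIdeal.isMaximal _).ne_top h2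

lemma aux_conn (X : Scheme.{u}) {ι K : Type*} [Finite ι] [Field K] (e : Γ(X, ⊤) ≃+* (ι → K)) :
    Nat.card (_root_.ConnectedComponents X) = Nat.card ι := by
  classical
  cases nonempty_fintype ι
  set ε : ι → Γ(X, ⊤) := fun i => e.symm (Pi.single i 1) with hε
  have hmul : ∀ (a : Γ(X, ⊤)) i, a * ε i = e.symm (Pi.single i (e a i)) := by
    intro a i
    apply e.injective
    ext j
    by_cases h : j = i
    · subst h; simp [hε]
    · simp [hε, h]
  have hsum : ∑ i, ε i = 1 := by
    rw [hε, ← map_sum, Finset.univ_sum_single (fun _ => (1 : K))]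
    exact map_one e.symm
  apply aux_topo (fun i => (X.basicOpen (ε i) : Set X))
  · exact fun i => (X.basicOpen (ε i)).isOpen
  · intro i j hij
    have : X.basicOpen (ε i) ⊓ X.basicOpen (ε j) = ⊥ := by
      rw [← Scheme.basicOpen_mul, hmul]
      simp [hε, hij.symm]
    exact congrArg (fun U : X.Opens => (U : Set X)) this
  · exact aux_cover X ε hsum
  · intro i
    by_contra hne
    rw [Set.not_nonempty_iff_eq_empty] at hne
    have hu : IsUnit (1 - ε i) := by
      apply aux_unit
      rw [eq_top_iff]
      intro x _
      obtain ⟨t, ht⟩ := aux_cover X (fun t : Bool => cond t (ε i) (1 - ε i)) (by simp) x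
      cases t with
      | true => exact absurd (show x ∈ (X.basicOpen (ε i) : Set X) from ht) (by simp [hne])
      | false => exact ht
    have h1 : (1 - ε i) * ε i = 0 := by rw [hmul]; simp [hε]
    have h2 := (hu.mul_right_eq_zero).mp h1
    have h3 := congrArg (fun a => e a i) h2
    simp [hε] at h3
  · intro i
    rw [isPreconnected_iff_subset_of_disjoint]
    intro u v hu hv hsub hdis
    let W : X.Opens := X.basicOpen (1 - ε i)
    have hW : X.basicOpen (ε i) ⊓ W = ⊥ := by
      rw [← Scheme.basicOpen_mul, mul_comm, hmul]; simp [hε]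
    have hW' : X.basicOpen (ε i) ⊔ W = ⊤ := by
      rw [eq_top_iff]
      intro x _
      obtain ⟨t, ht⟩ := aux_cover X (fun t : Bool => cond t (ε i) (1 - ε i)) (by simp) x
      cases t with
      | true => exact Or.inl ht
      | false => exact Or.inr ht
    let u' : X.Opens := ⟨u, hu⟩
    let v' : X.Opens := ⟨v, hv⟩
    have hs' : X.basicOpen (ε i) ≤ u' ⊔ v' := hsub
    have hd' : X.basicOpen (ε i) ⊓ (u' ⊓ v') = ⊥ := by
      ext x; exact Set.ext_iff.mp hdis x
    obtain ⟨a, ha⟩ := aux_clopen X (X.basicOpen (ε i) ⊓ u') ((X.basicOpen (ε i) ⊓ v') ⊔ W) (by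
      rw [inf_sup_left, inf_right_comm _ u' W, hW, ← inf_inf_distrib_left, hd', bot_inf_eq, bot_sup_eq]) (by
      rw [← sup_assoc, ← inf_sup_left, inf_eq_left.mpr hs', hW'])
    by_cases h0 : e a i = 0
    · right
      have h1 : X.basicOpen a ⊓ X.basicOpen (ε i) = ⊥ := by
        rw [← Scheme.basicOpen_mul, hmul, h0]; simp
      rw [ha] at h1
      intro x hx
      rcases hsub hx with h | h
      · have : x ∈ ((X.basicOpen (ε i) ⊓ u') ⊓ X.basicOpen (ε i) : X.Opens) := ⟨⟨hx, h⟩, hx⟩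
        rw [h1] at this
        exact this.elim
      · exact h
    · left
      have h1 : (e.symm (Pi.single i (e a i)⁻¹)) * a * ε i = ε i := by
        rw [hmul]; simp [hε, h0]
      have : X.basicOpen (ε i) ≤ X.basicOpen a := by
        conv_lhs => rw [← h1, Scheme.basicOpen_mul, Scheme.basicOpen_mul]
        exact inf_le_left.trans inf_le_right
      rw [ha] at this
      exact fun x hx => (this hx).2

lemma aux_idem (X : Scheme.{u}) [ConnectedSpace X] (a : Γ(X, ⊤)) (ha : a * a = a) : a = 0 ∨ a = 1 := by
  have hm : a * (1 - a) = 0 := by linear_combination -ha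
  have hW : X.basicOpen a ⊓ X.basicOpen (1 - a) = ⊥ := by
    rw [← Scheme.basicOpen_mul, hm]; simp
  have hW' : X.basicOpen a ⊔ X.basicOpen (1 - a) = ⊤ := by
    rw [eq_top_iff]
    intro x _
    obtain ⟨t, ht⟩ := aux_cover X (fun t : Bool => cond t a (1 - a)) (by simp) x
    cases t with
    | true => exact Or.inl ht
    | false => exact Or.inr ht
  have hcl : IsClopen (X.basicOpen a : Set X) := by
    refine ⟨⟨?_⟩, (X.basicOpen a).isOpen⟩
    have : (X.basicOpen a : Set X)ᶜ = (X.basicOpen (1 - a) : Set X) := by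
      have : IsCompl (X.basicOpen a : Set X) (X.basicOpen (1 - a) : Set X) := by
        refine IsCompl.of_eq ?_ ?_
        · exact congrArg (fun U : X.Opens => (U : Set X)) hW
        · exact congrArg (fun U : X.Opens => (U : Set X)) hW'
      exact this.compl_eq
    rw [this]
    exact (X.basicOpen _).isOpen
  rcases isClopen_iff.mp hcl with h | h
  · left
    have : X.basicOpen a = ⊥ := by ext x; exact Set.ext_iff.mp h x
    rw [this, bot_sup_eq] at hW'
    exact (aux_unit X _ hW').mul_left_eq_zero.mp hm
  · right
    have : X.basicOpen a = ⊤ := by ext x; exact Set.ext_iff.mp h x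
    have := (aux_unit X _ this).mul_right_eq_zero.mp hm
    linear_combination -this

lemma aux_finite (k : Type u) [Field k] (Y : Scheme.{u}) [Nonempty Y]
    (f : Y ⟶ Spec (CommRingCat.of k)) [LocallyOfFiniteType f] (hF : IsField Γ(Y, ⊤)) :
    letI φ : CommRingCat.of k ⟶ Γ(Y, ⊤) :=
      (Scheme.ΓSpecIso (CommRingCat.of k)).inv ≫ f.appTop
    letI : Algebra k Γ(Y, ⊤) := RingHom.toAlgebra φ.hom
    Module.Finite k Γ(Y, ⊤) := by
  let φ : CommRingCat.of k ⟶ Γ(Y, ⊤) :=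
    (Scheme.ΓSpecIso (CommRingCat.of k)).inv ≫ f.appTop
  let alg : Algebra k Γ(Y, ⊤) := RingHom.toAlgebra φ.hom
  obtain ⟨x⟩ := ‹Nonempty Y›
  obtain ⟨U, hU, hxU, -⟩ := exists_isAffineOpen_mem_and_subset (x := x) (U := ⊤) trivial
  let r : Γ(Y, ⊤) ⟶ Γ(Y, U) := Y.presheaf.map (homOfLE le_top).op
  let ψ := φ ≫ r
  have hψ : ψ.hom.FiniteType := by
    have h1 := f.finiteType_appLE (isAffineOpen_top (Spec (CommRingCat.of k))) hU le_top
    have h2 : ψ = (Scheme.ΓSpecIso (CommRingCat.of k)).inv ≫ f.appLE ⊤ U le_top := by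
      simp [ψ, φ, r, Scheme.Hom.appLE]
    rw [h2, CommRingCat.hom_comp]
    exact h1.comp (RingHom.FiniteType.of_surjective _
      (Scheme.ΓSpecIso (CommRingCat.of k)).symm.commRingCatIsoToRingEquiv.surjective)
  let algU : Algebra k Γ(Y, U) := RingHom.toAlgebra ψ.hom
  have : Algebra.FiniteType k Γ(Y, U) := hψ
  have : Nonempty U := ⟨⟨x, hxU⟩⟩
  obtain ⟨m, hm⟩ := Ideal.exists_maximal Γ(Y, U)
  letI := Ideal.Quotient.field m
  have : Module.Finite k (Γ(Y, U) ⧸ m) := finite_of_finite_type_of_isJacobsonRing k _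
  let g : Γ(Y, ⊤) →ₐ[k] Γ(Y, U) := { r.hom with commutes' := fun c => rfl }
  let g' : Γ(Y, ⊤) →ₐ[k] (Γ(Y, U) ⧸ m) := (Ideal.Quotient.mkₐ k m).comp g
  letI := hF.toField
  exact Module.Finite.of_injective g'.toLinearMap (RingHom.injective (g' : Γ(Y, ⊤) →+* (Γ(Y, U) ⧸ m)))

lemma aux_split (K B : Type u) [Field K] [IsSepClosed K] [CommRing B] [Algebra K B]
    [Module.Finite K B] [Algebra.FormallyEtale K B] :
    ∃ (ι : Type u) (_ : Finite ι), Nonempty (B ≃+* (ι → K)) ∧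
      Nat.card ι = Module.finrank K B := by
  let e' : B ≃ₐ[K] (PrimeSpectrum B → K) := Algebra.FormallyEtale.equivPiOfIsSepClosed K B
  have : IsArtinianRing B := isArtinian_of_tower K inferInstance
  have : Finite (PrimeSpectrum B) := inferInstance
  refine ⟨PrimeSpectrum B, this, ⟨e'.toRingEquiv⟩, ?_⟩
  cases nonempty_fintype (PrimeSpectrum B)
  rw [e'.toLinearEquiv.finrank_eq, Module.finrank_fintype_fun_eq_card, Nat.card_eq_fintype_card]

lemma aux_push (k K : Type u) [Field k] [Field K] [Algebra k K] (Y : Scheme.{u})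
    (f : Y ⟶ Spec (CommRingCat.of k)) [QuasiCompact f] [QuasiSeparated f] :
    letI φ : CommRingCat.of k ⟶ Γ(Y, ⊤) :=
      (Scheme.ΓSpecIso (CommRingCat.of k)).inv ≫ f.appTop
    letI : Algebra k Γ(Y, ⊤) := RingHom.toAlgebra φ.hom
    Nonempty (Γ(pullback f (Spec.map (CommRingCat.ofHom (algebraMap k K))), ⊤) ≃+*
      TensorProduct k K Γ(Y, ⊤)) := by
  let φ : CommRingCat.of k ⟶ Γ(Y, ⊤) :=
    (Scheme.ΓSpecIso (CommRingCat.of k)).inv ≫ f.appTop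
  let alg : Algebra k Γ(Y, ⊤) := RingHom.toAlgebra φ.hom
  have : CompactSpace Y := by
    exact (quasiCompact_iff_compactSpace (f := f)).mp inferInstance
  have : QuasiSeparatedSpace Y := by
    exact (quasiSeparated_iff_quasiSeparatedSpace f).mp inferInstance
  let j := Spec.map (CommRingCat.ofHom (algebraMap k K))
  have : Flat j := by
    rw [Flat.SpecMap_iff]
    exact (RingHom.flat_algebraMap_iff).mpr inferInstance
  have H := IsPullback.of_hasPullback f j
  have h1 := isIso_pushoutSection_of_isQuasiSeparated_of_flat_right H (US := ⊤) (UT := ⊤) (UX := ⊤)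
    (UY := ⊤) le_top le_top (by simp) (isAffineOpen_top _) (isAffineOpen_top _) isCompact_univ
    isQuasiSeparated_univ
  have h2 := (isIso_pushoutSection_iff H (US := ⊤) (UT := ⊤) (UX := ⊤)
    (UY := ⊤) le_top le_top (by simp)).mp h1
  have h3 : IsPushout (CommRingCat.ofHom (algebraMap k Γ(Y, ⊤)))
      (CommRingCat.ofHom (algebraMap k K)) ((pullback.fst f j).appLE ⊤ ⊤ (by simp))
      ((Scheme.ΓSpecIso (CommRingCat.of K)).inv ≫ (pullback.snd f j).appLE ⊤ ⊤ (by simp)) := by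
    refine h2.of_iso (Scheme.ΓSpecIso (CommRingCat.of k)) (Iso.refl _)
      (Scheme.ΓSpecIso (CommRingCat.of K)) (Iso.refl _) ?_ ?_ ?_ ?_
    · change f.appLE ⊤ ⊤ _ ≫ 𝟙 _ = (Scheme.ΓSpecIso (CommRingCat.of k)).hom ≫ φ
      simp [φ, Scheme.Hom.appLE]; exact Category.comp_id _
    · simp [j, Scheme.Hom.appLE, ← Scheme.ΓSpecIso_naturality]; exact Category.comp_id _
    · simp
    · simp
  have h4 := (CommRingCat.isPushout_tensorProduct k K Γ(Y, ⊤)).flip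
  exact ⟨(h3.isoIsPushout _ _ h4).commRingCatIsoToRingEquiv⟩

set_option synthInstance.maxHeartbeats 400000 in
set_option maxHeartbeats 1000000 in
/-- Let `k` be a field with separable closure `kˢ` (realized as the
separable closure of `k` inside an algebraic closure), and let `Y` be a scheme that is proper
over `Spec k`, reduced and connected, such that the finite field extension `H⁰(Y, O_Y)` of `k`
is separable.  Then the number of connected components of the base change
`Y ×_{Spec k} Spec kˢ` equals `dim_k H⁰(Y, O_Y)`. -/
theorem card_connectedComponents_base_change_sep_closure
    (k : Type u) [Field k] (Y : Scheme.{u})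
    (f : Y ⟶ Spec (CommRingCat.of k))
    [IsProper f] [IsReduced Y] [ConnectedSpace Y] :
    letI φ : CommRingCat.of k ⟶ Γ(Y, ⊤) :=
      (Scheme.ΓSpecIso (CommRingCat.of k)).inv ≫ f.appTop
    letI : Algebra k Γ(Y, ⊤) := RingHom.toAlgebra φ.hom
    Algebra.IsSeparable k Γ(Y, ⊤) →
      Nat.card
        (_root_.ConnectedComponents
          ↥(pullback f (Spec.map (CommRingCat.ofHom
            (algebraMap k (separableClosure k (AlgebraicClosure k))))))) =
        Module.finrank k Γ(Y, ⊤) := by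
  intro hsep
  let φ : CommRingCat.of k ⟶ Γ(Y, ⊤) :=
    (Scheme.ΓSpecIso (CommRingCat.of k)).inv ≫ f.appTop
  let alg : Algebra k Γ(Y, ⊤) := RingHom.toAlgebra φ.hom
  have hnt : Nontrivial Γ(Y, ⊤) := by
    have : Nonempty (⊤ : Y.Opens) := ⟨⟨Classical.arbitrary Y, trivial⟩⟩
    infer_instance
  have hF : IsField Γ(Y, ⊤) := aux_field k _ (aux_idem Y)
  have hfin : Module.Finite k Γ(Y, ⊤) := aux_finite k Y f hF
  have het : Algebra.FormallyEtale k Γ(Y, ⊤) := by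
    letI := hF.toField
    exact Algebra.FormallyEtale.of_isSeparable k Γ(Y, ⊤)
  obtain ⟨e⟩ := aux_push k (separableClosure k (AlgebraicClosure k)) Y f
  let K := separableClosure k (AlgebraicClosure k)
  let B := TensorProduct k K Γ(Y, ⊤)
  have : IsSepClosed K := inferInstance
  obtain ⟨ι, hι, ⟨e'⟩, hcard⟩ := aux_split K B
  rw [aux_conn _ (e.trans e'), hcard]
  exact Module.finrank_baseChange
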